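/- Fix a > √2. For E > 0 small, define x₀(E) := a·√(log(1/E)), t(E) := x₀(E)/2 + log(x₀(E)/E − 1)/x₀(E), and P_e(E) := (1 − E/x₀(E))·Q(t(E)) + (E/x₀(E))·Q(x₀(E) − t(E)). Then limsup_{E → 0⁺} P_e(E) · √(2π) · (a/2 + 1/a) · √(log(1/E)) / E^{(1/2)·(a/2 + 1/a)²} ≤ 1. -/

import Mathlib

/-- The standard normal density. -/
noncomputable def stdNormalPDF (x : ℝ) : ℝ :=
  (1 / Real.sqrt (2 * Real.pi)) * Real.exp (-x ^ 2 / 2)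

/-- The standard normal tail function `Q(x) = ∫_x^∞ φ(u) du`. -/
noncomputable def stdNormalQ (x : ℝ) : ℝ :=
  ∫ u in Set.Ioi x, stdNormalPDF u

theorem stdNormalPDF_pos (x : ℝ) : 0 < stdNormalPDF x := by
  unfold stdNormalPDF
  positivity

theorem stdNormalQ_nonneg (x : ℝ) : 0 ≤ stdNormalQ x :=
  MeasureTheory.setIntegral_nonneg measurableSet_Ioi fun u _ => (stdNormalPDF_pos u).le

theorem hasDerivAt_neg_stdNormalPDF (x : ℝ) :
    HasDerivAt (fun u => -stdNormalPDF u) (x * stdNormalPDF x) x := by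
  unfold stdNormalPDF
  have h : HasDerivAt (fun u : ℝ => -u ^ 2 / 2) (-x) x := by
    refine ((hasDerivAt_pow 2 x).neg.div_const 2).congr_deriv ?_
    push_cast
    ring
  refine (h.exp.const_mul (1 / Real.sqrt (2 * Real.pi))).neg.congr_deriv ?_
  ring

theorem integrable_stdNormalPDF : MeasureTheory.Integrable stdNormalPDF := by
  unfold stdNormalPDF
  refine MeasureTheory.Integrable.const_mul ?_ _
  convert integrable_exp_neg_mul_sq (b := 1 / 2) (by norm_num) using 3
  ring

theorem tendsto_stdNormalPDF_atTop :
    Filter.Tendsto stdNormalPDF Filter.atTop (nhds 0) := by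
  unfold stdNormalPDF
  rw [← mul_zero (1 / Real.sqrt (2 * Real.pi))]
  refine Filter.Tendsto.const_mul _ (Real.tendsto_exp_atBot.comp ?_)
  have h := (Filter.tendsto_pow_atTop (α := ℝ) two_ne_zero).atTop_div_const (two_pos (α := ℝ))
  simp only [neg_div]
  exact Filter.tendsto_neg_atTop_atBot.comp h

/-- The Mills ratio upper bound `Q(t) ≤ φ(t) / t`. -/
theorem stdNormalQ_le_stdNormalPDF_div {t : ℝ} (ht : 0 < t) :
    stdNormalQ t ≤ stdNormalPDF t / t := by
  have hnonneg : ∀ u ∈ Set.Ioi t, 0 ≤ u * stdNormalPDF u := fun u hu =>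
    mul_nonneg (ht.trans hu).le (stdNormalPDF_pos u).le
  have hlim : Filter.Tendsto (fun u => -stdNormalPDF u) Filter.atTop (nhds 0) := by
    simpa using tendsto_stdNormalPDF_atTop.neg
  have hint : MeasureTheory.IntegrableOn (fun u => u * stdNormalPDF u) (Set.Ioi t) :=
    MeasureTheory.integrableOn_Ioi_deriv_of_nonneg'
      (fun u _ => hasDerivAt_neg_stdNormalPDF u) hnonneg hlim
  have heq : ∫ u in Set.Ioi t, u * stdNormalPDF u = stdNormalPDF t := by
    rw [MeasureTheory.integral_Ioi_of_hasDerivAt_of_tendsto'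
      (fun u _ => hasDerivAt_neg_stdNormalPDF u) hint hlim]
    ring
  rw [le_div_iff₀ ht, ← heq, stdNormalQ, ← MeasureTheory.integral_mul_const]
  refine MeasureTheory.setIntegral_mono_on
    (integrable_stdNormalPDF.integrableOn.mul_const t) hint measurableSet_Ioi fun u hu => ?_
  rw [mul_comm]
  exact mul_le_mul_of_nonneg_right (le_of_lt hu) (stdNormalPDF_pos u).le

theorem stdNormalQ_mul_sqrt_le {t : ℝ} (ht : 0 < t) :
    stdNormalQ t * Real.sqrt (2 * Real.pi) ≤ Real.exp (-t ^ 2 / 2) / t := by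
  have h2π : 0 < Real.sqrt (2 * Real.pi) := by positivity
  calc stdNormalQ t * Real.sqrt (2 * Real.pi)
      ≤ stdNormalPDF t / t * Real.sqrt (2 * Real.pi) :=
        mul_le_mul_of_nonneg_right (stdNormalQ_le_stdNormalPDF_div ht) h2π.le
    _ = Real.exp (-t ^ 2 / 2) / t := by
        unfold stdNormalPDF
        field_simp

/-- With `x` the nonzero input, `u = √(log (1 / E))` and `ℓ = log (x - E)`, an explicit bound for
the error probability of the maximum a posteriori rule, whose threshold is
`t = x / 2 + (ℓ + u ^ 2) / x`. -/
theorem map_error_mul_sqrt_le {a u ℓ : ℝ} (ha : 0 < a) (had : 0 < a / 2 - 1 / a) (hu : 0 < u)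
    (hℓ : 0 ≤ ℓ) (hexp : Real.exp ℓ = a * u - Real.exp (-u ^ 2))
    (hsmall : ℓ / (a * u) ≤ (a / 2 - 1 / a) / 2 * u)
    (hlarge : Real.log (1 + 2 * (a / 2 + 1 / a) / (a / 2 - 1 / a)) ≤ (a / 2 + 1 / a) / a * ℓ) :
    ((1 - Real.exp (-u ^ 2) / (a * u)) * stdNormalQ (a * u / 2 + (ℓ + u ^ 2) / (a * u)) +
      Real.exp (-u ^ 2) / (a * u) * stdNormalQ (a * u - (a * u / 2 + (ℓ + u ^ 2) / (a * u)))) *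
      Real.sqrt (2 * Real.pi) * (a / 2 + 1 / a) * u ≤
      Real.exp (-(u ^ 2 * ((1 / 2 : ℝ) * (a / 2 + 1 / a) ^ 2))) := by
  set t := a * u / 2 + (ℓ + u ^ 2) / (a * u) with ht_def
  set c := a / 2 + 1 / a with hc_def
  set d := a / 2 - 1 / a with hd_def
  set p := Real.exp (-u ^ 2) / (a * u) with hp_def
  have hx : 0 < a * u := by positivity
  have hc : 0 < c := by positivity
  have hp : 0 ≤ p := by positivity
  have hp1 : p ≤ 1 := by
    rw [hp_def, div_le_one hx]
    linarith [Real.exp_pos ℓ]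
  have hr : 0 ≤ ℓ / (a * u) := by positivity
  have ht : t = c * u + ℓ / (a * u) := by
    rw [ht_def, hc_def]
    field_simp
    ring
  have hxt : a * u - t = d * u - ℓ / (a * u) := by
    rw [ht, hc_def, hd_def]
    ring
  have ht_ge : c * u ≤ t := by linarith
  have hxt_ge : d / 2 * u ≤ a * u - t := by linarith
  have hcu : 0 < c * u := by positivity
  have hdu : 0 < d / 2 * u := by positivity
  have ht0 : 0 < t := hcu.trans_le ht_ge
  have hxt0 : 0 < a * u - t := hdu.trans_le hxt_ge
  set G := Real.exp (-t ^ 2 / 2) with hG_def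
  have hG : 0 < G := Real.exp_pos _
  have hbalance : p * Real.exp (-(a * u - t) ^ 2 / 2) = (1 - p) * G := by
    have hexponent : -(a * u - t) ^ 2 / 2 = ℓ + u ^ 2 + -t ^ 2 / 2 := by
      have : a * u * t = (a * u) ^ 2 / 2 + ℓ + u ^ 2 := by
        rw [ht_def]
        field_simp
        ring
      linear_combination this
    have hp' : 1 - p = Real.exp ℓ / (a * u) := by
      rw [hexp, hp_def, sub_div, div_self hx.ne']
    rw [hp', hexponent, Real.exp_add, Real.exp_add, hp_def, hG_def, Real.exp_neg]
    have := (Real.exp_pos (u ^ 2)).ne'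
    field_simp
  have hfirst : (1 - p) * (stdNormalQ t * Real.sqrt (2 * Real.pi)) ≤ G / (c * u) :=
    calc (1 - p) * (stdNormalQ t * Real.sqrt (2 * Real.pi))
        ≤ 1 * (stdNormalQ t * Real.sqrt (2 * Real.pi)) :=
          mul_le_mul_of_nonneg_right (by linarith)
            (mul_nonneg (stdNormalQ_nonneg t) (Real.sqrt_nonneg _))
      _ ≤ G / t := by
          rw [one_mul]
          exact stdNormalQ_mul_sqrt_le ht0
      _ ≤ G / (c * u) := by gcongr
  have hsecond : p * (stdNormalQ (a * u - t) * Real.sqrt (2 * Real.pi)) ≤ G / (d / 2 * u) :=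
    calc p * (stdNormalQ (a * u - t) * Real.sqrt (2 * Real.pi))
        ≤ p * (Real.exp (-(a * u - t) ^ 2 / 2) / (a * u - t)) :=
          mul_le_mul_of_nonneg_left (stdNormalQ_mul_sqrt_le hxt0) hp
      _ = (1 - p) * G / (a * u - t) := by rw [← mul_div_assoc, hbalance]
      _ ≤ G / (a * u - t) := by
          gcongr
          nlinarith
      _ ≤ G / (d / 2 * u) := by gcongr
  have hG_le : G ≤ Real.exp (-(u ^ 2 * ((1 / 2 : ℝ) * c ^ 2))) / (1 + 2 * c / d) := by
    have hpos : 0 < 1 + 2 * c / d := by positivity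
    rw [hG_def, ← Real.exp_log hpos, ← Real.exp_sub, Real.exp_le_exp]
    have hcross : c * u * (ℓ / (a * u)) = c / a * ℓ := by field_simp
    rw [ht]
    nlinarith [sq_nonneg (ℓ / (a * u))]
  calc ((1 - p) * stdNormalQ t + p * stdNormalQ (a * u - t)) * Real.sqrt (2 * Real.pi) * c * u
      = ((1 - p) * (stdNormalQ t * Real.sqrt (2 * Real.pi)) +
          p * (stdNormalQ (a * u - t) * Real.sqrt (2 * Real.pi))) * (c * u) := by ring
    _ ≤ (G / (c * u) + G / (d / 2 * u)) * (c * u) := by gcongr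
    _ = G * (1 + 2 * c / d) := by field_simp
    _ ≤ Real.exp (-(u ^ 2 * ((1 / 2 : ℝ) * c ^ 2))) := by
        rwa [← le_div_iff₀ (by positivity)]

theorem tendsto_sqrt_log_one_div_nhdsGT_zero :
    Filter.Tendsto (fun E : ℝ => Real.sqrt (Real.log (1 / E))) (nhdsWithin 0 (Set.Ioi 0))
      Filter.atTop := by
  simp only [one_div]
  exact Real.tendsto_sqrt_atTop.comp (Real.tendsto_log_atTop.comp tendsto_inv_nhdsGT_zero)

theorem gaussian_MAP_error_asymptotic {a : ℝ} (ha : Real.sqrt 2 < a) :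
    Filter.limsup
      (fun E : ℝ =>
        let x₀ : ℝ := a * Real.sqrt (Real.log (1 / E))
        let t : ℝ := x₀ / 2 + Real.log (x₀ / E - 1) / x₀
        let Pe : ℝ := (1 - E / x₀) * stdNormalQ t + (E / x₀) * stdNormalQ (x₀ - t)
        Pe * Real.sqrt (2 * Real.pi) * (a / 2 + 1 / a) * Real.sqrt (Real.log (1 / E)) /
          E ^ ((1 / 2 : ℝ) * (a / 2 + 1 / a) ^ 2))
      (nhdsWithin 0 (Set.Ioi 0)) ≤ 1 := by
  have ha0 : 0 < a := (Real.sqrt_nonneg 2).trans_lt ha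
  have hsq : 2 < a ^ 2 := (Real.sqrt_lt' ha0).1 ha
  have had : 0 < a / 2 - 1 / a := by
    have : a / 2 - 1 / a = (a ^ 2 - 2) / (2 * a) := by field_simp
    rw [this]
    exact div_pos (by linarith) (by positivity)
  have hu_tendsto := tendsto_sqrt_log_one_div_nhdsGT_zero
  have hx_tendsto := hu_tendsto.const_mul_atTop ha0
  have hE_lt : ∀ᶠ E : ℝ in nhdsWithin 0 (Set.Ioi 0), E < 1 :=
    nhdsWithin_le_nhds (eventually_lt_nhds one_pos)
  have hy_tendsto : Filter.Tendsto
      (fun E : ℝ => a * Real.sqrt (Real.log (1 / E)) - E) (nhdsWithin 0 (Set.Ioi 0))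
      Filter.atTop := by
    refine Filter.tendsto_atTop_mono' _ ?_
      (Filter.tendsto_atTop_add_const_right _ (-1 : ℝ) hx_tendsto)
    filter_upwards [hE_lt] with E hE
    linarith
  have hℓ_tendsto := (Real.tendsto_log_atTop.comp hy_tendsto).const_mul_atTop
    (show 0 < (a / 2 + 1 / a) / a by positivity)
  have hmain : ∀ᶠ E : ℝ in nhdsWithin 0 (Set.Ioi 0),
      let x₀ : ℝ := a * Real.sqrt (Real.log (1 / E))
      let t : ℝ := x₀ / 2 + Real.log (x₀ / E - 1) / x₀
      let Pe : ℝ := (1 - E / x₀) * stdNormalQ t + (E / x₀) * stdNormalQ (x₀ - t)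
      let F : ℝ := Pe * Real.sqrt (2 * Real.pi) * (a / 2 + 1 / a) *
        Real.sqrt (Real.log (1 / E)) / E ^ ((1 / 2 : ℝ) * (a / 2 + 1 / a) ^ 2)
      0 ≤ F ∧ F ≤ 1 := by
    filter_upwards [self_mem_nhdsWithin, hE_lt, hy_tendsto.eventually_ge_atTop 1,
      hℓ_tendsto.eventually_ge_atTop (Real.log (1 + 2 * (a / 2 + 1 / a) / (a / 2 - 1 / a))),
      hu_tendsto.eventually_ge_atTop (1 / ((a / 2 - 1 / a) / 2))] with E hE hE1 hy hlarge hu_ge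
    have hE0 : (0 : ℝ) < E := hE
    dsimp only [Function.comp_apply] at hlarge
    have hL : 0 < Real.log (1 / E) := Real.log_pos (by rw [lt_div_iff₀ hE0]; linarith)
    set u := Real.sqrt (Real.log (1 / E)) with hu_def
    have hu : 0 < u := Real.sqrt_pos.2 hL
    have hu2 : u ^ 2 = -Real.log E := by rw [hu_def, Real.sq_sqrt hL.le, one_div, Real.log_inv]
    have hEu : E = Real.exp (-u ^ 2) := by rw [hu2, neg_neg, Real.exp_log hE0]
    have hx : 0 < a * u := by positivity
    have hlog : Real.log (a * u / E - 1) = Real.log (a * u - E) + u ^ 2 := by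
      rw [div_sub_one hE0.ne', Real.log_div (by linarith) hE0.ne', hu2]
      ring
    have hsmall : Real.log (a * u - E) / (a * u) ≤ (a / 2 - 1 / a) / 2 * u := by
      rw [div_le_iff₀ (by positivity)] at hu_ge
      have hle : Real.log (a * u - E) / (a * u) ≤ 1 := by
        rw [div_le_one hx]
        linarith [Real.log_le_sub_one_of_pos (show 0 < a * u - E by linarith)]
      linarith
    have hpow : E ^ ((1 / 2 : ℝ) * (a / 2 + 1 / a) ^ 2) =
        Real.exp (-(u ^ 2 * ((1 / 2 : ℝ) * (a / 2 + 1 / a) ^ 2))) := by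
      rw [Real.rpow_def_of_pos hE0, hu2]
      ring_nf
    have hbound := map_error_mul_sqrt_le ha0 had hu (Real.log_nonneg hy)
      (by rw [← hEu, Real.exp_log (by linarith)]) hsmall hlarge
    rw [← hEu] at hbound
    have hp1 : E / (a * u) ≤ 1 := by
      rw [div_le_one hx]
      linarith
    intro x₀ t Pe F
    have hPe : 0 ≤ Pe := add_nonneg
      (mul_nonneg (sub_nonneg.2 hp1) (stdNormalQ_nonneg _))
      (mul_nonneg (by positivity) (stdNormalQ_nonneg _))
    refine ⟨by positivity, ?_⟩
    simp only [F, Pe, t, x₀, hlog, hpow]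
    rw [div_le_one (Real.exp_pos _)]
    exact hbound
  refine Filter.limsup_le_of_le ?_ (hmain.mono fun E h => h.2)
  exact Filter.IsCoboundedUnder.of_frequently_ge (hmain.mono fun E h => h.1).frequently
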